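/- Let Q = q = p^r and m = 2, with N_1 − 1 and N_2 − 1 dividing q − 1. Let J ⊆ {1,2} and assume that p divides N_j for each j ∉ J. For i = 1, 2 set r(N_i) = ⌊(N_i − 1)/2⌋ if N_i is even and r(N_i) = (N_i − 1)/2 − 1 if N_i is odd. Let t ≤ n_J be a positive integer and suppose one of the following holds: (i) J = ∅ and (t ≤ r(N_1) + 2 or t ≤ r(N_2) + 2); (ii) J = {1} and (t ≤ r(N_1) + 1 or t ≤ r(N_2) + 2); (iii) J = {1,2} and (t ≤ r(N_1) + 1 or t ≤ r(N_2) + 1). Then F(J,t) ⊆ F(J,t)^⊥ (Euclidean duality), dim_{F_q} F(J,t) = card(N(J,t)), and every nonzero codeword of F(J,t)^⊥ has Hamming weight at least t. -/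

import Mathlib

/-- `ε_j = 1` if `j ∈ J` and `0` otherwise. -/
def eps {m : ℕ} (J : Finset (Fin m)) (j : Fin m) : ℕ := if j ∈ J then 1 else 0

/-- The points `Z_J` of the `J`-affine variety. -/
def ZJ (F : Type) [Field F] [Fintype F] [DecidableEq F] {m : ℕ} (N : Fin m → ℕ)
    (J : Finset (Fin m)) : Finset (Fin m → F) :=
  Finset.univ.filter
    (fun x => ∀ j, (j ∈ J → x j ^ (N j - 1) = 1) ∧ (j ∉ J → x j ^ (N j) = x j))

/-- Evaluation of the monomial `X^b` at all the points of `Z_J`. -/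
def evm (F : Type) [Field F] [Fintype F] [DecidableEq F] {m : ℕ} (N : Fin m → ℕ)
    (J : Finset (Fin m)) (b : Fin m → ℕ) : ↥(ZJ F N J) → F :=
  fun P => ∏ j, P.1 j ^ b j

/-- The set `N(J,t)` of exponent tuples. -/
def NSet {m : ℕ} (N : Fin m → ℕ) (J : Finset (Fin m)) (t : ℕ) : Set (Fin m → ℕ) :=
  { b | (∀ j, eps J j ≤ b j ∧ b j ≤ N j - 1) ∧ ∏ j, (b j + 1 - eps J j) < t }

/-- The code `F(J,t)`: the span of the evaluations of the monomials with exponents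
in `N(J,t)`. -/
noncomputable def Fcode (F : Type) [Field F] [Fintype F] [DecidableEq F] {m : ℕ}
    (N : Fin m → ℕ) (J : Finset (Fin m)) (t : ℕ) : Submodule F (↥(ZJ F N J) → F) :=
  Submodule.span F { v | ∃ b ∈ NSet N J t, v = evm F N J b }

/-- `r(N_i) = ⌊(N_i − 1)/2⌋` if `N_i` is even and `(N_i − 1)/2 − 1` if `N_i` is odd. -/
def rN (n : ℕ) : ℕ := if Even n then (n - 1) / 2 else (n - 1) / 2 - 1

section JAffine

open Finset Polynomial

variable {F : Type} [Field F] [Fintype F] [DecidableEq F]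

/-- The coordinate set of the variety `Z_J` in direction `j`. -/
def coordZJ (F : Type) [Field F] [Fintype F] [DecidableEq F] {m : ℕ} (N : Fin m → ℕ)
    (J : Finset (Fin m)) (j : Fin m) : Finset F :=
  univ.filter (fun a => (j ∈ J → a ^ (N j - 1) = 1) ∧ (j ∉ J → a ^ (N j) = a))

theorem mem_coordZJ {m : ℕ} {N : Fin m → ℕ} {J : Finset (Fin m)} {j : Fin m} {a : F} :
    a ∈ coordZJ F N J j ↔ (j ∈ J → a ^ (N j - 1) = 1) ∧ (j ∉ J → a ^ (N j) = a) := by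
  simp [coordZJ]

theorem mem_ZJ_iff_forall_mem_coordZJ {m : ℕ} {N : Fin m → ℕ} {J : Finset (Fin m)}
    {x : Fin m → F} : x ∈ ZJ F N J ↔ ∀ j, x j ∈ coordZJ F N J j := by
  simp [ZJ, mem_coordZJ]

theorem ZJ_eq_piFinset {m : ℕ} (N : Fin m → ℕ) (J : Finset (Fin m)) :
    ZJ F N J = Fintype.piFinset (coordZJ F N J) := by
  ext x
  rw [mem_ZJ_iff_forall_mem_coordZJ, Fintype.mem_piFinset]

theorem exists_isPrimitiveRoot_of_dvd_card_sub_one {n : ℕ} (hn : n ∣ Fintype.card F - 1) :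
    ∃ ζ : F, IsPrimitiveRoot ζ n := by
  obtain ⟨g, hg⟩ := IsCyclic.exists_ofOrder_eq_natCard (α := Fˣ)
  have hcard : Nat.card Fˣ = Fintype.card F - 1 := by
    rw [Nat.card_eq_fintype_card, Fintype.card_units]
  obtain ⟨k, hk⟩ := hn
  have hprim : IsPrimitiveRoot (g : F) (Fintype.card F - 1) := by
    rw [← hcard, ← hg, ← orderOf_units]
    exact IsPrimitiveRoot.orderOf _
  have hpos : 0 < Fintype.card F - 1 := by
    have := Fintype.one_lt_card (α := F)
    omega
  exact ⟨(g : F) ^ k, hprim.pow hpos (by rw [hk, mul_comm])⟩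

theorem card_coordZJ {m : ℕ} {N : Fin m → ℕ} (J : Finset (Fin m)) {j : Fin m}
    (hN : 1 < N j) (hdvd : (N j - 1) ∣ (Fintype.card F - 1)) :
    (coordZJ F N J j).card = N j - eps J j := by
  obtain ⟨ζ, hζ⟩ := exists_isPrimitiveRoot_of_dvd_card_sub_one hdvd
  have hpos : 0 < N j - 1 := by omega
  have hroots := hζ.card_nthRootsFinset
  by_cases hj : j ∈ J
  · have : coordZJ F N J j = nthRootsFinset (N j - 1) (1 : F) := by
      ext a
      simp [mem_coordZJ, hj, mem_nthRootsFinset hpos]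
    rw [this, hroots, eps, if_pos hj]
  · have h0 : (0 : F) ∉ nthRootsFinset (N j - 1) (1 : F) := by
      simp [mem_nthRootsFinset hpos, hpos.ne']
    have : coordZJ F N J j = insert 0 (nthRootsFinset (N j - 1) (1 : F)) := by
      ext a
      obtain ⟨n, hn⟩ : ∃ n, N j = n + 1 := ⟨N j - 1, by omega⟩
      have hn0 : n ≠ 0 := by omega
      rw [mem_coordZJ, mem_insert, mem_nthRootsFinset hpos, hn]
      by_cases ha : a = 0
      · simp [hj, ha]
      · simp [hj, ha, pow_succ]
    rw [this, card_insert_of_notMem h0, hroots, eps, if_neg hj]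
    omega

/-- Multiplication by a root of unity of order `N j - 1` permutes the coordinate set. -/
theorem sum_coordZJ_pow_eq_zero {m : ℕ} {N : Fin m → ℕ} (J : Finset (Fin m)) {j : Fin m}
    (hdvd : (N j - 1) ∣ (Fintype.card F - 1)) {k : ℕ} (hk : 0 < k) (hkN : k < N j - 1) :
    ∑ a ∈ coordZJ F N J j, a ^ k = 0 := by
  obtain ⟨ζ, hζ⟩ := exists_isPrimitiveRoot_of_dvd_card_sub_one hdvd
  have hζ0 : ζ ≠ 0 := hζ.ne_zero (by omega)
  have hζN : ζ ^ (N j) = ζ := by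
    obtain ⟨n, hn⟩ : ∃ n, N j = n + 1 := ⟨N j - 1, by omega⟩
    have := hζ.pow_eq_one
    rw [hn, Nat.add_sub_cancel] at this
    rw [hn, pow_succ, this, one_mul]
  have hmem : ∀ a, ζ * a ∈ coordZJ F N J j ↔ a ∈ coordZJ F N J j := by
    intro a
    simp [mem_coordZJ, mul_pow, hζ.pow_eq_one, hζN, hζ0]
  have hshift : ∑ a ∈ coordZJ F N J j, (ζ * a) ^ k = ∑ a ∈ coordZJ F N J j, a ^ k :=
    sum_equiv (Equiv.mulLeft₀ ζ hζ0) (by simp [hmem]) (by simp)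
  simp_rw [mul_pow, ← mul_sum] at hshift
  by_contra hne
  exact hζ.pow_ne_one_of_pos_of_lt hk.ne' hkN (mul_right_cancel₀ hne (hshift.trans (one_mul _).symm))

theorem sum_evm_mul_evm {m : ℕ} (N : Fin m → ℕ) (J : Finset (Fin m)) (a b : Fin m → ℕ) :
    ∑ P, evm F N J a P * evm F N J b P = ∏ j, ∑ x ∈ coordZJ F N J j, x ^ (a j + b j) := by
  rw [prod_univ_sum, ← ZJ_eq_piFinset, ← sum_coe_sort (ZJ F N J)]
  simp [evm, pow_add, prod_mul_distrib]

theorem sum_mul_eq_zero_of_mem_Fcode {m : ℕ} {N : Fin m → ℕ} {J : Finset (Fin m)} {t : ℕ}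
    (h : ∀ a ∈ NSet N J t, ∀ b ∈ NSet N J t, ∑ P, evm F N J a P * evm F N J b P = 0)
    {x y : ↥(ZJ F N J) → F} (hx : x ∈ Fcode F N J t) (hy : y ∈ Fcode F N J t) :
    ∑ P, x P * y P = 0 := by
  have hle : Fcode F N J t ≤
      LinearMap.ker (dotProductBilin F F |>.flip y : (↥(ZJ F N J) → F) →ₗ[F] F) := by
    refine Submodule.span_le.2 ?_
    rintro _ ⟨a, ha, rfl⟩
    have hle' : Fcode F N J t ≤ LinearMap.ker (dotProductBilin F F (evm F N J a)) := by
      refine Submodule.span_le.2 ?_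
      rintro _ ⟨b, hb, rfl⟩
      exact h a ha b hb
    exact hle' hy
  exact hle hx

/-- A coordinate all of whose exponents are small makes the code self-orthogonal. -/
theorem sum_evm_mul_evm_eq_zero {m : ℕ} {N : Fin m → ℕ} {J : Finset (Fin m)} {t : ℕ} (p : ℕ)
    [CharP F p] (hN : ∀ j, 1 < N j) (hdvd : ∀ j, (N j - 1) ∣ (Fintype.card F - 1))
    {j : Fin m} (hp : j ∉ J → p ∣ N j) (ht : t + eps J j ≤ rN (N j) + 2)
    {a b : Fin m → ℕ} (ha : a ∈ NSet N J t) (hb : b ∈ NSet N J t) :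
    ∑ P, evm F N J a P * evm F N J b P = 0 := by
  have hsmall : ∀ c ∈ NSet N J t, c j + 1 - eps J j < t := by
    intro c hc
    refine lt_of_le_of_lt (single_le_prod' (f := fun i => c i + 1 - eps J i) (fun i _ => ?_)
      (mem_univ j)) hc.2
    have := (hc.1 i).1
    show 1 ≤ c i + 1 - eps J i
    omega
  have h1 := hsmall a ha
  have h2 := hsmall b hb
  have h3 := (ha.1 j).1
  have h4 := (hb.1 j).1
  have hr : 2 * rN (N j) < N j - 1 := by
    have := hN j
    unfold rN
    split_ifs with hev
    · obtain ⟨k, hk⟩ := hev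
      omega
    · rw [Nat.not_even_iff_odd] at hev
      obtain ⟨k, hk⟩ := hev
      omega
  rw [sum_evm_mul_evm]
  refine prod_eq_zero (mem_univ j) ?_
  by_cases h0 : a j + b j = 0
  · have hj : j ∉ J := by
      intro hj
      simp only [eps, if_pos hj] at h3
      omega
    have hcard := card_coordZJ (F := F) J (hN j) (hdvd j)
    rw [eps, if_neg hj, Nat.sub_zero] at hcard
    simp [h0, hcard, (CharP.cast_eq_zero_iff F p (N j)).2 (hp hj)]
  · exact sum_coordZJ_pow_eq_zero J (hdvd j) (by omega) (by omega)

theorem pow_eps_ne_zero {m : ℕ} {N : Fin m → ℕ} {J : Finset (Fin m)} (hN : ∀ j, 1 < N j)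
    (P : ↥(ZJ F N J)) (j : Fin m) : P.1 j ^ eps J j ≠ 0 := by
  by_cases hj : j ∈ J
  · have h := (mem_coordZJ.1 (mem_ZJ_iff_forall_mem_coordZJ.1 P.2 j)).1 hj
    refine pow_ne_zero _ fun h0 => ?_
    have := hN j
    rw [h0, zero_pow (by omega)] at h
    exact zero_ne_one h
  · simp [eps, hj]

theorem eval_mul_eval_mem_Fcode {N : Fin 2 → ℕ} {J : Finset (Fin 2)} {t : ℕ} {f g : F[X]}
    (hf : f.natDegree + eps J 0 ≤ N 0 - 1) (hg : g.natDegree + eps J 1 ≤ N 1 - 1)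
    (ht : (f.natDegree + 1) * (g.natDegree + 1) < t) :
    (fun P : ↥(ZJ F N J) =>
      P.1 0 ^ eps J 0 * f.eval (P.1 0) * (P.1 1 ^ eps J 1 * g.eval (P.1 1))) ∈ Fcode F N J t := by
  have hsum : (fun P : ↥(ZJ F N J) =>
      P.1 0 ^ eps J 0 * f.eval (P.1 0) * (P.1 1 ^ eps J 1 * g.eval (P.1 1))) =
      ∑ k ∈ range (f.natDegree + 1), ∑ l ∈ range (g.natDegree + 1),
        (f.coeff k * g.coeff l) • evm F N J ![k + eps J 0, l + eps J 1] := by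
    funext P
    simp only [Finset.sum_apply, Pi.smul_apply, smul_eq_mul, evm, Fin.prod_univ_two,
      Matrix.cons_val_zero, Matrix.cons_val_one]
    rw [eval_eq_sum_range, eval_eq_sum_range, mul_sum, mul_sum, sum_mul_sum]
    refine sum_congr rfl fun k _ => sum_congr rfl fun l _ => ?_
    ring
  rw [hsum]
  refine Submodule.sum_mem _ fun k hk => Submodule.sum_mem _ fun l hl =>
    Submodule.smul_mem _ _ (Submodule.subset_span ⟨_, ⟨?_, ?_⟩, rfl⟩)
  · rw [mem_range] at hk hl
    rw [Fin.forall_fin_two]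
    simp only [Matrix.cons_val_zero, Matrix.cons_val_one]
    omega
  · rw [mem_range] at hk hl
    rw [Fin.prod_univ_two]
    simp only [Matrix.cons_val_zero, Matrix.cons_val_one]
    refine lt_of_le_of_lt (Nat.mul_le_mul ?_ ?_) ht <;> omega

theorem le_card_support_of_orthogonal_Fcode {N : Fin 2 → ℕ} {J : Finset (Fin 2)} {t : ℕ}
    (hN : ∀ j, 1 < N j) (hdvd : ∀ j, (N j - 1) ∣ (Fintype.card F - 1))
    {y : ↥(ZJ F N J) → F} (hy : ∀ x ∈ Fcode F N J t, ∑ P, x P * y P = 0) (hy0 : y ≠ 0) :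
    t ≤ (univ.filter (fun P => y P ≠ 0)).card := by
  set S : Finset ↥(ZJ F N J) := univ.filter (fun P => y P ≠ 0) with hS
  by_contra! hlt
  obtain ⟨P₁, hP₁⟩ := Function.ne_iff.1 hy0
  have hP₁S : P₁ ∈ S := by simpa [hS] using hP₁
  set A : Finset F := S.image (fun P => P.1 0) with hA
  obtain ⟨a, haA, hamin⟩ := exists_min_image A
    (fun c => (S.filter (fun P => P.1 0 = c)).card) ⟨_, mem_image_of_mem _ hP₁S⟩
  set B : Finset F := (S.filter (fun P => P.1 0 = a)).image (fun P => P.1 1) with hB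
  obtain ⟨P₀, hP₀S, hP₀a⟩ := mem_image.1 haA
  have hP₀B : P₀.1 1 ∈ B := mem_image.2 ⟨P₀, mem_filter.2 ⟨hP₀S, hP₀a⟩, rfl⟩
  have hAB : A.card * B.card ≤ S.card := by
    rw [card_eq_sum_card_image (fun P : ↥(ZJ F N J) => P.1 0) S]
    refine (card_nsmul_le_sum A _ _ fun c hc => ?_)
    exact card_image_le.trans (hamin c hc)
  have hApos : 0 < A.card := card_pos.2 ⟨a, haA⟩
  have hBpos : 0 < B.card := card_pos.2 ⟨_, hP₀B⟩
  have hcoord : ∀ (T : Finset ↥(ZJ F N J)) (j : Fin 2),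
      (T.image (fun P => P.1 j)).card ≤ N j - eps J j := by
    intro T j
    rw [← card_coordZJ (F := F) J (hN j) (hdvd j)]
    refine card_le_card (image_subset_iff.2 fun P _ => ?_)
    exact mem_ZJ_iff_forall_mem_coordZJ.1 P.2 j
  have hAN := hcoord S 0
  have hBN := hcoord (S.filter (fun P => P.1 0 = a)) 1
  rw [← hA] at hAN
  rw [← hB] at hBN
  set f : F[X] := ∏ c ∈ A.erase a, (X - C c) with hf
  set g : F[X] := ∏ c ∈ B.erase (P₀.1 1), (X - C c) with hg
  have hfdeg : f.natDegree = A.card - 1 := by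
    rw [hf, natDegree_finsetProd_X_sub_C_eq_card, card_erase_of_mem haA]
  have hgdeg : g.natDegree = B.card - 1 := by
    rw [hg, natDegree_finsetProd_X_sub_C_eq_card, card_erase_of_mem hP₀B]
  have hmem := eval_mul_eval_mem_Fcode (N := N) (J := J) (t := t) (f := f) (g := g)
    (by omega) (by omega)
    (by rw [hfdeg, hgdeg, Nat.sub_add_cancel hApos, Nat.sub_add_cancel hBpos]; omega)
  have hzero := hy _ hmem
  have hroot : ∀ (s : Finset F) (c : F), (∏ d ∈ s, (X - C d)).eval c = 0 ↔ c ∈ s := by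
    intro s c
    simp [eval_prod, prod_eq_zero_iff, sub_eq_zero]
  rw [sum_eq_single P₀] at hzero
  · have hfne : f.eval (P₀.1 0) ≠ 0 := by
      rw [hf, Ne, hroot, hP₀a]
      exact notMem_erase _ _
    have hgne : g.eval (P₀.1 1) ≠ 0 := by
      rw [hg, Ne, hroot]
      exact notMem_erase _ _
    exact mul_ne_zero (mul_ne_zero (mul_ne_zero (pow_eps_ne_zero hN P₀ 0) hfne)
      (mul_ne_zero (pow_eps_ne_zero hN P₀ 1) hgne)) (mem_filter.1 hP₀S).2 hzero
  · intro P _ hPne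
    by_cases hPS : P ∈ S
    · by_cases hPa : P.1 0 = a
      · have hne : P.1 1 ≠ P₀.1 1 := by
          intro h
          refine hPne (Subtype.ext (funext fun j => ?_))
          fin_cases j
          · exact hPa.trans hP₀a.symm
          · exact h
        have : g.eval (P.1 1) = 0 := (hroot _ _).2
          (mem_erase.2 ⟨hne, mem_image.2 ⟨P, mem_filter.2 ⟨hPS, hPa⟩, rfl⟩⟩)
        simp [this]
      · have : f.eval (P.1 0) = 0 := (hroot _ _).2
          (mem_erase.2 ⟨hPa, mem_image_of_mem _ hPS⟩)
        simp [this]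
    · have : y P = 0 := by simpa [hS] using hPS
      simp [this]
  · exact fun h => absurd (mem_univ _) h

theorem Fcode_eq_top {N : Fin 2 → ℕ} {J : Finset (Fin 2)} {t : ℕ}
    (hN : ∀ j, 1 < N j) (hdvd : ∀ j, (N j - 1) ∣ (Fintype.card F - 1))
    (ht : (ZJ F N J).card < t) : Fcode F N J t = ⊤ := by
  by_contra hne
  obtain ⟨φ, hφ, hle⟩ := Submodule.exists_le_ker_of_lt_top _ (lt_top_iff_ne_top.2 hne)
  have hy := le_card_support_of_orthogonal_Fcode (t := t) hN hdvd
    (y := fun P => φ (Pi.single P 1)) ?_ ?_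
  · have := card_le_univ (univ.filter (fun P : ↥(ZJ F N J) => φ (Pi.single P 1) ≠ 0))
    rw [Fintype.card_coe] at this
    omega
  · intro x hx
    have h := LinearMap.mem_ker.1 (hle hx)
    rw [LinearMap.pi_apply_eq_sum_univ] at h
    refine Eq.trans (sum_congr rfl fun P _ => ?_) h
    rw [smul_eq_mul]
    congr 2
    funext R
    simp [Pi.single_apply, eq_comm]
  · intro h
    refine hφ (LinearMap.pi_ext' fun P => LinearMap.ext_ring ?_)
    simpa using congrFun h P

theorem linearIndependent_evm {N : Fin 2 → ℕ} {J : Finset (Fin 2)}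
    (hN : ∀ j, 1 < N j) (hdvd : ∀ j, (N j - 1) ∣ (Fintype.card F - 1)) :
    LinearIndependent F (fun b : ↥(Fintype.piFinset fun j => Icc (eps J j) (N j - 1)) =>
      evm F N J b.1) := by
  refine linearIndependent_of_top_le_span_of_card_eq_finrank ?_ ?_
  · rw [← Fcode_eq_top hN hdvd (Nat.lt_succ_self (ZJ F N J).card)]
    refine Submodule.span_mono ?_
    rintro _ ⟨b, hb, rfl⟩
    exact ⟨⟨b, Fintype.mem_piFinset.2 fun j => mem_Icc.2 (hb.1 j)⟩, rfl⟩
  · rw [Module.finrank_fintype_fun_eq_card, Fintype.card_coe, Fintype.card_coe, ZJ_eq_piFinset,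
      Fintype.card_piFinset, Fintype.card_piFinset]
    refine prod_congr rfl fun j _ => ?_
    rw [card_coordZJ J (hN j) (hdvd j), Nat.card_Icc, Nat.sub_add_cancel (hN j).le]

theorem finrank_Fcode {N : Fin 2 → ℕ} {J : Finset (Fin 2)} (t : ℕ)
    (hN : ∀ j, 1 < N j) (hdvd : ∀ j, (N j - 1) ∣ (Fintype.card F - 1)) :
    Module.finrank F (Fcode F N J t) = Nat.card (NSet N J t) := by
  let incl : NSet N J t → ↥(Fintype.piFinset fun j => Icc (eps J j) (N j - 1)) :=
    fun b => ⟨b.1, Fintype.mem_piFinset.2 fun j => mem_Icc.2 (b.2.1 j)⟩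
  have hincl : Function.Injective incl := fun b c h => Subtype.ext (congrArg (fun d => d.1) h)
  have hli := (linearIndependent_evm (F := F) hN hdvd).comp incl hincl
  have : Finite (NSet N J t) := Finite.of_injective incl hincl
  have := Fintype.ofFinite (NSet N J t)
  have hset : {v | ∃ b ∈ NSet N J t, v = evm F N J b} =
      Set.range ((fun b : ↥(Fintype.piFinset fun j => Icc (eps J j) (N j - 1)) =>
        evm F N J b.1) ∘ incl) := by
    ext v
    simp [incl, eq_comm]
  rw [Nat.card_eq_fintype_card, ← finrank_span_eq_card hli, Fcode, hset]

end JAffine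

/-- Corollary 1 of the paper, bivariate case.  Under the displayed
conditions on `t` (depending on `J ⊆ {1,2}`), the code `F(J,t)` is Euclidean
self-orthogonal, has dimension `card N(J,t)`, and its dual has minimum distance at
least `t`. -/
theorem Fcode_bivariate_euclidean_self_orthogonal
    (p e : ℕ) (hp : p.Prime) (he : 0 < e)
    (F : Type) [Field F] [Fintype F] [DecidableEq F]
    (hF : Fintype.card F = p ^ e)
    (N : Fin 2 → ℕ) (hN : ∀ j, 1 < N j)
    (hNdvd : ∀ j, (N j - 1) ∣ (Fintype.card F - 1))
    (J : Finset (Fin 2)) (hpN : ∀ j ∉ J, p ∣ N j)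
    (t : ℕ) (ht : 1 ≤ t) (htn : t ≤ ∏ j, (N j - eps J j))
    (hcases :
      (J = (∅ : Finset (Fin 2)) ∧ (t ≤ rN (N 0) + 2 ∨ t ≤ rN (N 1) + 2)) ∨
      (J = ({0} : Finset (Fin 2)) ∧ (t ≤ rN (N 0) + 1 ∨ t ≤ rN (N 1) + 2)) ∨
      (J = ({0, 1} : Finset (Fin 2)) ∧ (t ≤ rN (N 0) + 1 ∨ t ≤ rN (N 1) + 1))) :
    (∀ x ∈ Fcode F N J t, ∀ y ∈ Fcode F N J t, ∑ i, x i * y i = 0) ∧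
    Module.finrank F (Fcode F N J t) = Nat.card (NSet N J t) ∧
    (∀ y : ↥(ZJ F N J) → F,
      (∀ x ∈ Fcode F N J t, ∑ i, x i * y i = 0) → y ≠ 0 →
      t ≤ (Finset.univ.filter (fun i => y i ≠ 0)).card) := by
  have : Fact p.Prime := ⟨hp⟩
  have : CharP F p := charP_of_card_eq_prime_pow hF
  refine ⟨fun x hx y hy => ?_, finrank_Fcode t hN hNdvd,
    fun y hy hy0 => le_card_support_of_orthogonal_Fcode hN hNdvd hy hy0⟩
  obtain ⟨j, hj⟩ : ∃ j, t + eps J j ≤ rN (N j) + 2 := by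
    rw [Fin.exists_fin_two]
    rcases hcases with ⟨rfl, h⟩ | ⟨rfl, h⟩ | ⟨rfl, h⟩ <;> simp [eps] <;> omega
  exact sum_mul_eq_zero_of_mem_Fcode
    (fun a ha b hb => sum_evm_mul_evm_eq_zero p hN hNdvd (hpN j) hj ha hb) hx hy
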